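/- Let G be a graph with minimum degree δ > 2s/t (s, t positive integers) and algebraic connectivity μ₂(G) > 2s/(t(δ+1)). Assuming the fractional spanning tree packing theorem (μ₂(G) > (2s'-1)/(t'(δ+1)) implies η(G) ≥ s'/t' for positive integers s', t' with δ ≥ 2s'/t') and η(tG) = t·η(G), it follows that η(tG) > s, and hence tG - e contains at least s edge-disjoint spanning trees for every edge e of tG. -/

import Mathlib

open Matrix

/-- Number of connected components of the multigraph on vertex set `V` with edge
multiset `E`. -/
noncomputable def numComponents {V : Type*} [Fintype V] [DecidableEq V]
    (E : Multiset (Sym2 V)) : ℕ :=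
  Nat.card (Quot (fun a b : V => s(a, b) ∈ E))

/-- The strength (fractional spanning tree packing number) of the multigraph with
edge multiset `E`. -/
noncomputable def strength {V : Type*} [Fintype V] [DecidableEq V]
    (E : Multiset (Sym2 V)) : ℝ :=
  sInf { r : ℝ | ∃ X ≤ E, 1 < numComponents (E - X) ∧
    r = (Multiset.card X : ℝ) / ((numComponents (E - X) : ℝ) - 1) }

/-- A sub-multiset of edges is a spanning tree if it connects all of `V` and has
`|V| - 1` edges. -/
def IsSpanningTree {V : Type*} [Fintype V] [DecidableEq V]
    (T : Multiset (Sym2 V)) : Prop :=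
  numComponents T = 1 ∧ Multiset.card T = Fintype.card V - 1

/-- The multigraph with edge multiset `E` contains `k` edge-disjoint spanning trees. -/
def HasEdgeDisjointSpanningTrees {V : Type*} [Fintype V] [DecidableEq V]
    (E : Multiset (Sym2 V)) (k : ℕ) : Prop :=
  ∃ Ts : Fin k → Multiset (Sym2 V), (∑ i, Ts i) ≤ E ∧ ∀ i, IsSpanningTree (Ts i)

/-- The algebraic connectivity `μ₂` of a Laplacian matrix `L`, via the variational
characterization. -/
noncomputable def mu2 {n : Type*} [Fintype n] (L : Matrix n n ℝ) : ℝ :=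
  sInf { r : ℝ | ∃ x : n → ℝ, x ≠ 0 ∧ (∑ v, x v) = 0 ∧
    r = (x ⬝ᵥ L.mulVec x) / (x ⬝ᵥ x) }

/-- The `ℚ`-valued functions on the vertices that are constant along every edge of `E`. -/
def edgeConstant {V : Type*} (E : Multiset (Sym2 V)) : Submodule ℚ (V → ℚ) where
  carrier := {x | ∀ a b, s(a, b) ∈ E → x a = x b}
  add_mem' := by
    intro x y hx hy a b h
    simp [hx a b h, hy a b h]
  zero_mem' := by
    intro a b _
    rfl
  smul_mem' := by
    intro c x hx a b h
    simp [hx a b h]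

section Components

variable {V : Type*}

lemma mem_edgeConstant {E : Multiset (Sym2 V)} {x : V → ℚ} :
    x ∈ edgeConstant E ↔ ∀ a b, s(a, b) ∈ E → x a = x b := Iff.rfl

lemma edgeConstant_anti {E F : Multiset (Sym2 V)} (h : E ⊆ F) :
    edgeConstant F ≤ edgeConstant E :=
  fun _ hx a b hab => hx a b (h hab)

lemma edgeConstant_cons (e : Sym2 V) (E : Multiset (Sym2 V)) :
    edgeConstant (e ::ₘ E) = edgeConstant {e} ⊓ edgeConstant E := by
  ext x
  simp only [Submodule.mem_inf, mem_edgeConstant, Multiset.mem_cons, Multiset.mem_singleton]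
  grind

/-- Functions constant along the edges are functions on the set of components. -/
def edgeConstantEquiv (E : Multiset (Sym2 V)) :
    edgeConstant E ≃ₗ[ℚ] (Quot (fun a b : V => s(a, b) ∈ E) → ℚ) where
  toFun x := Quot.lift x.1 x.2
  invFun y := ⟨fun v => y (Quot.mk _ v), fun _ _ h => congrArg y (Quot.sound h)⟩
  map_add' x y := by
    ext q
    induction q using Quot.ind
    rfl
  map_smul' c x := by
    ext q
    induction q using Quot.ind
    rfl
  left_inv x := rfl
  right_inv y := by
    ext q
    induction q using Quot.ind
    rfl

variable [Fintype V] [DecidableEq V]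

lemma finrank_edgeConstant (E : Multiset (Sym2 V)) :
    Module.finrank ℚ (edgeConstant E) = numComponents E := by
  classical
  have : Finite (Quot (fun a b : V => s(a, b) ∈ E)) := Quot.finite _
  have := Fintype.ofFinite (Quot (fun a b : V => s(a, b) ∈ E))
  rw [(edgeConstantEquiv E).finrank_eq, Module.finrank_fintype_fun_eq_card, numComponents,
    Nat.card_eq_fintype_card]

lemma numComponents_anti {E F : Multiset (Sym2 V)} (h : E ⊆ F) :
    numComponents F ≤ numComponents E := by
  rw [← finrank_edgeConstant, ← finrank_edgeConstant]
  exact Submodule.finrank_mono (edgeConstant_anti h)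

lemma numComponents_pos [Nonempty V] (E : Multiset (Sym2 V)) : 0 < numComponents E := by
  have : Finite (Quot (fun a b : V => s(a, b) ∈ E)) := Quot.finite _
  have : Nonempty (Quot (fun a b : V => s(a, b) ∈ E)) := ‹Nonempty V›.map (Quot.mk _)
  exact Nat.card_pos

lemma numComponents_zero : numComponents (0 : Multiset (Sym2 V)) = Fintype.card V := by
  have : edgeConstant (0 : Multiset (Sym2 V)) = ⊤ := by
    ext x
    simp [mem_edgeConstant]
  rw [← finrank_edgeConstant, this, finrank_top, Module.finrank_fintype_fun_eq_card]

/-- The number of components is a supermodular function of the edge set. -/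
lemma numComponents_supermodular {A B U I : Multiset (Sym2 V)}
    (hU : ∀ e ∈ U, e ∈ A ∨ e ∈ B) (hA : I ⊆ A) (hB : I ⊆ B) :
    numComponents A + numComponents B ≤ numComponents U + numComponents I := by
  simp only [← finrank_edgeConstant]
  rw [← Submodule.finrank_sup_add_finrank_inf_eq, add_comm]
  refine add_le_add (Submodule.finrank_mono ?_) (Submodule.finrank_mono ?_)
  · rintro x ⟨hxA, hxB⟩ a b h
    exact (hU _ h).elim (hxA a b) (hxB a b)
  · exact sup_le (edgeConstant_anti hA) (edgeConstant_anti hB)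

lemma card_le_numComponents_singleton_add_one (e : Sym2 V) :
    Fintype.card V ≤ numComponents {e} + 1 := by
  induction e with
  | h a b =>
    let π : V → (V → ℚ) →ₗ[ℚ] ℚ := LinearMap.proj
    let φ : (V → ℚ) →ₗ[ℚ] ℚ := π a - π b
    have hker : LinearMap.ker φ ≤ edgeConstant {s(a, b)} := by
      intro x hx c d hcd
      have hx' : x a = x b := by simpa [φ, π, sub_eq_zero] using hx
      have hcd' : s(c, d) = s(a, b) := by simpa using hcd
      rcases Sym2.eq_iff.mp hcd' with ⟨rfl, rfl⟩ | ⟨rfl, rfl⟩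
      · exact hx'
      · exact hx'.symm
    have h1 := LinearMap.finrank_range_add_finrank_ker φ
    have h2 := Submodule.finrank_le (LinearMap.range φ)
    have h3 := Submodule.finrank_mono hker
    rw [finrank_edgeConstant] at h3
    rw [Module.finrank_fintype_fun_eq_card] at h1
    rw [Module.finrank_self] at h2
    omega

lemma numComponents_le_cons_add_one (e : Sym2 V) (E : Multiset (Sym2 V)) :
    numComponents E ≤ numComponents (e ::ₘ E) + 1 := by
  have h1 := numComponents_supermodular (A := {e}) (B := E) (U := e ::ₘ E) (I := 0)
    (by simp) (Multiset.zero_subset _) (Multiset.zero_subset _)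
  have h2 := card_le_numComponents_singleton_add_one e
  rw [numComponents_zero] at h1
  omega

/-- Every multigraph has a maximal spanning forest. -/
lemma exists_spanning_forest (E : Multiset (Sym2 V)) :
    ∃ T ≤ E, edgeConstant T = edgeConstant E ∧
      Multiset.card T + numComponents T = Fintype.card V := by
  induction E using Multiset.induction with
  | empty => exact ⟨0, le_rfl, rfl, by simp [numComponents_zero]⟩
  | cons e E ih =>
    obtain ⟨T, hTE, hT, hcard⟩ := ih
    by_cases h : edgeConstant (e ::ₘ E) = edgeConstant E
    · exact ⟨T, hTE.trans (Multiset.le_cons_self E e), hT.trans h.symm, hcard⟩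
    · have hcons : edgeConstant (e ::ₘ T) = edgeConstant (e ::ₘ E) := by
        rw [edgeConstant_cons, edgeConstant_cons, hT]
      refine ⟨e ::ₘ T, Multiset.cons_le_cons e hTE, hcons, ?_⟩
      have hlt : edgeConstant (e ::ₘ T) < edgeConstant T := by
        refine lt_of_le_of_ne (edgeConstant_anti (Multiset.subset_cons T e)) ?_
        rwa [hcons, hT]
      have h1 := Submodule.finrank_lt_finrank_of_lt hlt
      rw [finrank_edgeConstant, finrank_edgeConstant] at h1
      have h2 := numComponents_le_cons_add_one e T
      rw [Multiset.card_cons]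
      omega

lemma exists_isSpanningTree_le {E : Multiset (Sym2 V)} (hE : numComponents E = 1) :
    ∃ T ≤ E, IsSpanningTree T := by
  obtain ⟨T, hTE, hT, hcard⟩ := exists_spanning_forest E
  have h1 : numComponents T = 1 := by
    rw [← hE, ← finrank_edgeConstant, hT, finrank_edgeConstant]
  exact ⟨T, hTE, h1, by omega⟩

end Components

section Packing

variable {V ι κ : Type*} [Fintype V] [DecidableEq V] [DecidableEq ι] [Fintype κ] [DecidableEq κ]

/-- If an edge `e` is allowed two different colours `i` and `j`, then one of them may be forbidden
without violating the Rado-type condition `|J| + ∑ₗ c(J ∩ A⁻¹(l)) ≤ M`. -/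
lemma rado_condition_erase (f : ι → Sym2 V) (M : ℕ) (A : ι → Finset κ)
    (hA : ∀ J : Finset ι,
      J.card + ∑ l, numComponents ((J.filter fun x => l ∈ A x).val.map f) ≤ M)
    {e : ι} {i j : κ} (hij : i ≠ j) :
    (∀ J : Finset ι, J.card + ∑ l, numComponents ((J.filter fun x =>
      l ∈ Function.update A e ((A e).erase i) x).val.map f) ≤ M) ∨
    (∀ J : Finset ι, J.card + ∑ l, numComponents ((J.filter fun x =>
      l ∈ Function.update A e ((A e).erase j) x).val.map f) ≤ M) := by
  have mem_of_violation : ∀ (i : κ) (J : Finset ι), M < J.card + ∑ l, numComponents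
      ((J.filter fun x => l ∈ Function.update A e ((A e).erase i) x).val.map f) → e ∈ J := by
    intro i J hJ
    by_contra he
    refine absurd (hA J) (not_le.mpr (hJ.trans_eq ?_))
    congr 1
    refine Finset.sum_congr rfl fun l _ => ?_
    congr 3
    refine Finset.filter_congr fun x hx => ?_
    rw [Function.update_of_ne (ne_of_mem_of_not_mem hx he)]
  by_contra! hcon
  obtain ⟨⟨J₁, h₁⟩, J₂, h₂⟩ := hcon
  have he₁ := mem_of_violation i J₁ h₁
  have he₂ := mem_of_violation j J₂ h₂
  have hU := hA (J₁ ∪ J₂)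
  have hI := hA ((J₁ ∩ J₂).erase e)
  have hcard := Finset.card_union_add_card_inter J₁ J₂
  have hcard' := Finset.card_erase_add_one (Finset.mem_inter.mpr ⟨he₁, he₂⟩)
  have hsum : (∑ l, numComponents ((J₁.filter fun x =>
        l ∈ Function.update A e ((A e).erase i) x).val.map f)) +
      (∑ l, numComponents ((J₂.filter fun x =>
        l ∈ Function.update A e ((A e).erase j) x).val.map f)) ≤
      (∑ l, numComponents (((J₁ ∪ J₂).filter fun x => l ∈ A x).val.map f)) +
      ∑ l, numComponents ((((J₁ ∩ J₂).erase e).filter fun x => l ∈ A x).val.map f) := by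
    rw [← Finset.sum_add_distrib, ← Finset.sum_add_distrib]
    refine Finset.sum_le_sum fun l _ => numComponents_supermodular ?_ ?_ ?_
    · intro y hy
      obtain ⟨x, hx, rfl⟩ := Multiset.mem_map.mp hy
      rw [Finset.mem_val, Finset.mem_filter, Finset.mem_union] at hx
      have key : x ∈ (J₁.filter fun x => l ∈ Function.update A e ((A e).erase i) x) ∨
          x ∈ (J₂.filter fun x => l ∈ Function.update A e ((A e).erase j) x) := by
        simp only [Finset.mem_filter, Function.update_apply]
        grind
      exact key.imp (Multiset.mem_map_of_mem f) (Multiset.mem_map_of_mem f)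
    all_goals
      refine Multiset.map_subset_map fun x hx => ?_
      simp only [Finset.mem_val, Finset.mem_filter, Finset.mem_erase, Finset.mem_inter] at hx ⊢
      rw [Function.update_of_ne hx.1.1]
      exact ⟨by tauto, hx.2⟩
  omega

lemma exists_rado_coloring [Fintype ι] (f : ι → Sym2 V) (M : ℕ) (A : ι → Finset κ)
    (hA : ∀ J : Finset ι,
      J.card + ∑ l, numComponents ((J.filter fun x => l ∈ A x).val.map f) ≤ M) :
    ∃ B : ι → Finset κ, (∀ x, (B x).card ≤ 1) ∧ ∀ J : Finset ι,
      J.card + ∑ l, numComponents ((J.filter fun x => l ∈ B x).val.map f) ≤ M := by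
  induction hn : ∑ x, (A x).card using Nat.strong_induction_on generalizing A with
  | _ n ih =>
    by_cases h : ∀ x, (A x).card ≤ 1
    · exact ⟨A, h, hA⟩
    · push Not at h
      obtain ⟨e, he⟩ := h
      obtain ⟨i, hi, j, hj, hij⟩ := Finset.one_lt_card.mp he
      have hlt : ∀ l ∈ A e, ∑ x, (Function.update A e ((A e).erase l) x).card < n := by
        intro l hl
        rw [← hn]
        refine Finset.sum_lt_sum (fun x _ => ?_) ⟨e, Finset.mem_univ e, ?_⟩
        · by_cases hx : x = e
          · subst hx
            simpa using Finset.card_le_card (Finset.erase_subset l (A x))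
          · rw [Function.update_of_ne hx]
        · simpa using Finset.card_erase_lt_of_mem hl
      rcases rado_condition_erase f M A hA (e := e) hij with h | h
      · exact ih _ (hlt i hi) _ h rfl
      · exact ih _ (hlt j hj) _ h rfl

/-- The Nash-Williams–Tutte theorem for an indexed family of edges. -/
lemma nashWilliams_tutte_indexed [Nonempty V] [Fintype ι] (f : ι → Sym2 V) (k : ℕ)
    (h : ∀ J : Finset ι, k * numComponents (J.val.map f) ≤ Jᶜ.card + k) :
    HasEdgeDisjointSpanningTrees ((Finset.univ : Finset ι).val.map f) k := by
  obtain ⟨B, hB, hB'⟩ := exists_rado_coloring f (Fintype.card ι + k)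
    (fun _ => (Finset.univ : Finset (Fin k))) (by
      intro J
      have hcard := Finset.card_add_card_compl J
      simp only [Finset.mem_univ, Finset.filter_true, Finset.sum_const, Finset.card_univ,
        Fintype.card_fin, smul_eq_mul]
      refine (Nat.add_le_add_left (h J) _).trans ?_
      omega)
  set C : Fin k → Finset ι := fun l => Finset.univ.filter fun x => l ∈ B x with hC
  have hsum : ∑ l, numComponents ((C l).val.map f) ≤ ∑ _l : Fin k, 1 := by
    have := hB' Finset.univ
    rw [Finset.card_univ] at this
    simpa only [Finset.sum_const, Finset.card_univ, smul_eq_mul, mul_one, Fintype.card_fin,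
      add_le_add_iff_left] using this
  have hone : ∀ l, numComponents ((C l).val.map f) = 1 := by
    have hle : ∀ l ∈ Finset.univ, 1 ≤ numComponents ((C l).val.map f) :=
      fun l _ => numComponents_pos _
    have heq := (Finset.sum_eq_sum_iff_of_le hle).mp (le_antisymm (Finset.sum_le_sum hle) hsum)
    exact fun l => (heq l (Finset.mem_univ l)).symm
  choose T hTC hT using fun l => exists_isSpanningTree_le (hone l)
  refine ⟨T, ?_, hT⟩
  have hdisj : ∑ l, (C l).val ≤ (Finset.univ : Finset ι).val := by
    rw [Multiset.le_iff_count]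
    intro x
    have hcount : ∀ l, Multiset.count x (C l).val = if l ∈ B x then 1 else 0 := by
      intro l
      rw [Multiset.count_eq_of_nodup (C l).nodup]
      simp [hC]
    rw [Multiset.count_sum', Multiset.count_eq_one_of_mem Finset.univ.nodup (Finset.mem_univ x)]
    simpa [hcount] using hB x
  calc ∑ l, T l ≤ ∑ l, (C l).val.map f := Finset.sum_le_sum fun l _ => hTC l
    _ = (∑ l, (C l).val).map f := (map_sum (Multiset.mapAddMonoidHom f) _ _).symm
    _ ≤ _ := Multiset.map_le_map hdisj

/-- The Nash-Williams–Tutte theorem: a multigraph in which every edge set `X` satisfies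
`k * (c(E - X) - 1) ≤ |X|` contains `k` edge-disjoint spanning trees. -/
theorem nashWilliams_tutte [Nonempty V] (E : Multiset (Sym2 V)) (k : ℕ)
    (h : ∀ X ≤ E, k * numComponents (E - X) ≤ Multiset.card X + k) :
    HasEdgeDisjointSpanningTrees E k := by
  classical
  have hE : (Finset.univ : Finset (Fin E.toList.length)).val.map E.toList.get = E := by
    rw [Fin.univ_val_map, List.ofFn_get, Multiset.coe_toList]
  rw [← hE]
  refine nashWilliams_tutte_indexed _ k fun J => ?_
  have hadd : J.val.map E.toList.get + Jᶜ.val.map E.toList.get = E := by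
    rw [← Multiset.map_add, ← Finset.disjUnion_val _ _ disjoint_compl_right,
      Finset.disjUnion_eq_union, Finset.union_compl, hE]
  have := h (Jᶜ.val.map E.toList.get) ((Multiset.le_add_left _ _).trans_eq hadd)
  rw [tsub_eq_of_eq_add hadd.symm] at this
  simpa using this

/-- A multigraph of strength greater than `k` keeps `k` edge-disjoint spanning trees after the
removal of any edge. -/
theorem hasEdgeDisjointSpanningTrees_erase_of_lt_strength [Nonempty V] {E : Multiset (Sym2 V)}
    {k : ℕ} (hk : (k : ℝ) < strength E) {e : Sym2 V} (he : e ∈ E) :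
    HasEdgeDisjointSpanningTrees (E.erase e) k := by
  refine nashWilliams_tutte _ k fun X hX => ?_
  have hX' : e ::ₘ X ≤ E := by
    rw [← Multiset.cons_erase he]
    exact Multiset.cons_le_cons e hX
  have hsub : E.erase e - X = E - e ::ₘ X := by rw [Multiset.sub_cons]
  rw [hsub]
  rcases Nat.lt_or_ge 1 (numComponents (E - e ::ₘ X)) with hc | hc
  · have hle : strength E ≤ (Multiset.card (e ::ₘ X) : ℝ) /
        ((numComponents (E - e ::ₘ X) : ℝ) - 1) := by
      refine csInf_le ⟨0, ?_⟩ ⟨_, hX', hc, rfl⟩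
      rintro r ⟨Y, -, hY, rfl⟩
      have : (1 : ℝ) < numComponents (E - Y) := by exact_mod_cast hY
      exact div_nonneg (Nat.cast_nonneg _) (by linarith)
    have hc' : (1 : ℝ) < numComponents (E - e ::ₘ X) := by exact_mod_cast hc
    have hlt := (lt_div_iff₀ (by linarith)).mp (hk.trans_le hle)
    rw [Multiset.card_cons] at hlt
    have : k * numComponents (E - e ::ₘ X) < Multiset.card X + 1 + k := by
      have : (k * numComponents (E - e ::ₘ X) : ℝ) < Multiset.card X + 1 + k := by
        push_cast at hlt
        linarith
      exact_mod_cast this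
    omega
  · calc k * numComponents (E - e ::ₘ X) ≤ k * 1 := Nat.mul_le_mul_left k hc
      _ ≤ _ := by omega

end Packing

theorem stmt_19 {V : Type*} [Fintype V] [DecidableEq V] (G : SimpleGraph V)
    [DecidableRel G.Adj] (s t : ℕ) (hs : 0 < s) (ht : 0 < t)
    (hδ : 2 * s < t * G.minDegree)
    (hmu : (2 * s : ℝ) / (t * ((G.minDegree : ℝ) + 1)) < mu2 (G.lapMatrix ℝ))
    -- the fractional spanning tree packing theorem, assumed:
    (hpack : ∀ s' t' : ℕ, 0 < s' → 0 < t' → 2 * s' ≤ t' * G.minDegree →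
      (2 * (s' : ℝ) - 1) / (t' * ((G.minDegree : ℝ) + 1)) < mu2 (G.lapMatrix ℝ) →
      (s' : ℝ) / (t' : ℝ) ≤ strength G.edgeFinset.val)
    -- the scaling law `η(tG) = t·η(G)`, assumed:
    (hscale : ∀ t'' : ℕ, strength (t'' • G.edgeFinset.val)
      = (t'' : ℝ) * strength G.edgeFinset.val) :
    (s : ℝ) < strength (t • G.edgeFinset.val) ∧
    ∀ e ∈ t • G.edgeFinset.val,
      HasEdgeDisjointSpanningTrees ((t • G.edgeFinset.val).erase e) s := by
  have hδpos : 0 < G.minDegree := by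
    rcases Nat.eq_zero_or_pos G.minDegree with h | h
    · simp [h] at hδ
    · exact h
  have hV : Nonempty V := by
    by_contra hV
    rw [not_nonempty_iff] at hV
    simp at hδpos
  have ht' : (0 : ℝ) < t := by exact_mod_cast ht
  have hlt : (s : ℝ) < strength (t • G.edgeFinset.val) := by
    obtain ⟨n, hn⟩ := exists_nat_one_div_lt (sub_pos.mpr hmu)
    have hN : (0 : ℝ) < (n : ℝ) + 2 := by positivity
    have h := hpack ((n + 2) * s + 1) ((n + 2) * t) (by positivity) (by positivity)
      (by nlinarith) (by
        have hD : (1 : ℝ) ≤ t * ((G.minDegree : ℝ) + 1) := by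
          exact_mod_cast Nat.succ_le_of_lt (Nat.mul_pos ht (Nat.succ_pos _))
        have heq : (2 * (((n + 2) * s + 1 : ℕ) : ℝ) - 1) /
            (((n + 2) * t : ℕ) * ((G.minDegree : ℝ) + 1)) =
            2 * s / (t * ((G.minDegree : ℝ) + 1)) +
              1 / (((n : ℝ) + 2) * (t * ((G.minDegree : ℝ) + 1))) := by
          push_cast
          field_simp
          ring
        have hle : 1 / (((n : ℝ) + 2) * (t * ((G.minDegree : ℝ) + 1))) ≤ 1 / ((n : ℝ) + 1) :=
          one_div_le_one_div_of_le (by positivity) (by nlinarith)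
        rw [heq]
        linarith)
    rw [hscale]
    push_cast at h
    rw [div_le_iff₀ (by positivity)] at h
    nlinarith
  exact ⟨hlt, fun e he => hasEdgeDisjointSpanningTrees_erase_of_lt_strength hlt he⟩
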